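/- For every rational number u, u > 0 if and only if there exist v₁ v₂ v₃ : ℚ such that (1 − u·(v₁^2 + v₂^2 + v₃^2)) · (1 − 2·u·(v₁^2 + v₂^2 + v₃^2)) = 0. -/

import Mathlib

set_option maxHeartbeats 1600000 in
theorem aux_pigeon (N p : ℕ) (hN : 0 < N) (hp : p.Prime) (hpN : ¬ p ∣ N) (hcop : Nat.Coprime N p)
    (h1 : (N : ℤ) ∣ p + 1) (r : ℤ) (hr : (p : ℤ) ∣ r ^ 2 - N) :
    ∃ Z V W : ℤ, W ≠ 0 ∧ Z ^ 2 + p * V ^ 2 = N * W ^ 2 := by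
  haveI : NeZero N := ⟨hN.ne'⟩
  haveI : NeZero p := ⟨hp.ne_zero⟩
  have hp0 : 0 < p := hp.pos
  set A := Nat.sqrt (N * p) with hA
  set B := Nat.sqrt N with hB
  set C := Nat.sqrt p with hC
  let S : Finset (ℕ × ℕ × ℕ) :=
    Finset.range (A + 1) ×ˢ (Finset.range (B + 1) ×ˢ Finset.range (C + 1))
  let f : ℕ × ℕ × ℕ → ZMod N × ZMod p := fun t =>
    (((t.1 : ℤ) - (t.2.1 : ℤ) : ℤ), ((t.1 : ℤ) - r * (t.2.2 : ℤ) : ℤ))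
  have hcard : (Finset.univ : Finset (ZMod N × ZMod p)).card < S.card := by
    have a1 : N * p < (A + 1) * (A + 1) := Nat.lt_succ_sqrt _
    have a2 : N < (B + 1) * (B + 1) := Nat.lt_succ_sqrt _
    have a3 : p < (C + 1) * (C + 1) := Nat.lt_succ_sqrt _
    simp only [S, Finset.card_product, Finset.card_range, Finset.card_univ, Fintype.card_prod,
      ZMod.card]
    have a4 : N * p < ((B + 1) * (B + 1)) * ((C + 1) * (C + 1)) :=
      Nat.mul_lt_mul'' a2 a3
    have a5 := Nat.mul_lt_mul'' a1 a4
    by_contra hcon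
    push Not at hcon
    have := Nat.mul_le_mul hcon hcon
    nlinarith
  obtain ⟨s, hs, t, ht, hst, hf⟩ :=
    Finset.exists_ne_map_eq_of_card_lt_of_maps_to hcard (f := f) (fun _ _ => Finset.mem_univ _)
  obtain ⟨s1, s2, s3⟩ := s
  obtain ⟨t1, t2, t3⟩ := t
  simp only [S, Finset.coe_product, Set.mem_prod, Finset.mem_coe, Finset.mem_product,
    Finset.mem_range] at hs ht
  obtain ⟨hs1, hs2, hs3⟩ := hs
  obtain ⟨ht1, ht2, ht3⟩ := ht
  simp only [f, Prod.mk.injEq] at hf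
  obtain ⟨hf1, hf2⟩ := hf
  rw [ZMod.intCast_eq_intCast_iff_dvd_sub] at hf1 hf2
  obtain ⟨z, hz⟩ : ∃ z : ℤ, z = t1 - s1 := ⟨_, rfl⟩
  obtain ⟨v, hv⟩ : ∃ v : ℤ, v = t2 - s2 := ⟨_, rfl⟩
  obtain ⟨w, hw⟩ : ∃ w : ℤ, w = t3 - s3 := ⟨_, rfl⟩
  have hzv : (N : ℤ) ∣ z - v := by rw [hz, hv]; convert hf1 using 1; ring
  have hzw : (p : ℤ) ∣ z - r * w := by rw [hz, hw]; convert hf2 using 1; ring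
  have bA : (A : ℤ) * A ≤ N * p := by exact_mod_cast Nat.sqrt_le (N * p)
  have bB : (B : ℤ) * B ≤ N := by exact_mod_cast Nat.sqrt_le N
  have bC : (C : ℤ) * C ≤ p := by exact_mod_cast Nat.sqrt_le p
  have hz2 : z ^ 2 ≤ N * p := by
    have : z ^ 2 ≤ (A : ℤ) ^ 2 := sq_le_sq' (by omega) (by omega)
    nlinarith
  have hv2 : v ^ 2 ≤ N := by
    have : v ^ 2 ≤ (B : ℤ) ^ 2 := sq_le_sq' (by omega) (by omega)
    nlinarith
  have hw2 : w ^ 2 ≤ p := by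
    have : w ^ 2 ≤ (C : ℤ) ^ 2 := sq_le_sq' (by omega) (by omega)
    nlinarith
  have hpZ : Prime (p : ℤ) := Nat.prime_iff_prime_int.mp hp
  have hNZ : (0 : ℤ) < N := by exact_mod_cast hN
  have hpZ0 : (0 : ℤ) < p := by exact_mod_cast hp0
  have hw2' : w ^ 2 < p := by
    refine lt_of_le_of_ne hw2 fun h => ?_
    have hd : (p : ℤ) ∣ w := hpZ.dvd_of_dvd_pow (n := 2) (by rw [h])
    obtain ⟨k, rfl⟩ := hd
    have h3 : (p : ℤ) * k ^ 2 = 1 := by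
      apply mul_left_cancel₀ hpZ0.ne'
      linarith
    exact hpZ.not_dvd_one ⟨_, h3.symm⟩
  have hz2' : z ^ 2 < N * p := by
    refine lt_of_le_of_ne hz2 fun h => ?_
    have hd : (p : ℤ) ∣ z := hpZ.dvd_of_dvd_pow (n := 2) (by rw [h]; exact dvd_mul_left _ _)
    obtain ⟨k, rfl⟩ := hd
    have h3 : (p : ℤ) * k ^ 2 = N := by
      apply mul_left_cancel₀ hpZ0.ne'
      linarith
    exact hpN (Int.natCast_dvd_natCast.mp ⟨_, h3.symm⟩)
  have hne : ¬ (z = 0 ∧ v = 0 ∧ w = 0) := by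
    rintro ⟨e1, e2, e3⟩
    apply hst
    simp only [Prod.mk.injEq]
    omega
  have d1 : (N : ℤ) ∣ z ^ 2 + p * v ^ 2 - N * w ^ 2 := by
    obtain ⟨a, ha⟩ := hzv
    obtain ⟨b, hb⟩ := h1
    have e1 : z = v + N * a := by linarith
    have e2 : (p : ℤ) = N * b - 1 := by linarith
    refine ⟨2 * v * a + N * a ^ 2 + b * v ^ 2 - w ^ 2, ?_⟩
    rw [e1, e2]; ring
  have d2 : (p : ℤ) ∣ z ^ 2 + p * v ^ 2 - N * w ^ 2 := by
    obtain ⟨a, ha⟩ := hzw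
    obtain ⟨b, hb⟩ := hr
    have e1 : z = r * w + p * a := by linarith
    have e2 : (N : ℤ) = r ^ 2 - p * b := by linarith
    refine ⟨2 * r * w * a + p * a ^ 2 + v ^ 2 + b * w ^ 2, ?_⟩
    rw [e1, e2]; ring
  have d3 : (N : ℤ) * p ∣ z ^ 2 + p * v ^ 2 - N * w ^ 2 :=
    IsCoprime.mul_dvd (Nat.isCoprime_iff_coprime.mpr hcop) d1 d2
  obtain ⟨k, hk⟩ := d3
  have hNp : (0 : ℤ) < N * p := mul_pos hNZ hpZ0
  have hpv : (p : ℤ) * v ^ 2 ≤ p * N := mul_le_mul_of_nonneg_left hv2 hpZ0.le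
  have hNw : (N : ℤ) * w ^ 2 < N * p := mul_lt_mul_of_pos_left hw2' hNZ
  have hpv0 : (0 : ℤ) ≤ p * v ^ 2 := by positivity
  have hNw0 : (0 : ℤ) ≤ N * w ^ 2 := by positivity
  have k1 : k < 2 := by
    by_contra hc
    push Not at hc
    nlinarith
  have k2 : -1 < k := by
    by_contra hc
    push Not at hc
    nlinarith [sq_nonneg z]
  have k3 : k = 0 ∨ k = 1 := by omega
  rcases k3 with rfl | rfl
  · refine ⟨z, v, w, ?_, by linarith⟩
    rintro rfl
    apply hne
    have e : z ^ 2 + p * v ^ 2 = 0 := by linarith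
    have e1 : z ^ 2 = 0 := by nlinarith [sq_nonneg z]
    have e2 : p * v ^ 2 = 0 := by nlinarith [sq_nonneg z]
    refine ⟨by simpa using e1, ?_, rfl⟩
    rcases mul_eq_zero.mp e2 with h | h
    · exact absurd h hpZ0.ne'
    · simpa using h
  · refine ⟨z * w - p * v, z + v * w, w ^ 2 + p, by positivity, ?_⟩
    linear_combination (w ^ 2 + p) * hk

theorem aux_prime (m : ℕ) (hm : Odd m) :
    ∃ p : ℕ, p.Prime ∧ m * 2 < p ∧ p % 4 = 1 ∧ ((2 * m : ℕ) : ℤ) ∣ p + 1 ∧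
      ∃ r : ℤ, (p : ℤ) ∣ r ^ 2 - (2 * m : ℕ) := by
  have hm0 : 0 < m := hm.pos
  let c : ℕ := if m % 4 = 1 then 1 else 5
  have hcop : Nat.Coprime 8 m := by
    have : Nat.Coprime (2 ^ 3) m := Nat.Coprime.pow_left 3 (Nat.coprime_two_left.mpr hm)
    simpa using this
  obtain ⟨x, hx8, hxm⟩ := Nat.chineseRemainder hcop c (m - 1)
  have hm4 : m % 4 = 1 ∨ m % 4 = 3 := by
    rcases hm with ⟨k, rfl⟩; omega
  have hx8' : x % 8 = c := by
    have := hx8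
    unfold Nat.ModEq at this
    rw [this]; simp only [c]; split_ifs <;> rfl
  have hxm' : m ∣ x + 1 := by
    have h : x + 1 ≡ m - 1 + 1 [MOD m] := hxm.add_right 1
    rw [Nat.sub_add_cancel hm0] at h
    exact (Nat.modEq_zero_iff_dvd.mp (h.trans (by simp [Nat.ModEq])))
  have hx8o : x % 8 = 1 ∨ x % 8 = 5 := by
    rw [hx8']; simp only [c]; split_ifs <;> simp
  have hxcop : Nat.Coprime x (8 * m) := by
    apply Nat.Coprime.mul_right
    · have : Nat.Coprime x (2 ^ 3) :=
        Nat.Coprime.pow_right 3 (Nat.coprime_two_right.mpr (Nat.odd_iff.mpr (by omega)))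
      simpa using this
    · have : Nat.Coprime x (x + 1) := by simp
      exact this.coprime_dvd_right hxm'
  haveI : NeZero (8 * m) := ⟨by positivity⟩
  obtain ⟨p, hpgt, hp, hpx⟩ := Nat.forall_exists_prime_gt_and_modEq (m * 2) (q := 8 * m)
    (by positivity) hxcop
  have hp8 : p % 8 = c := by
    have : p ≡ x [MOD 8] := hpx.of_dvd (dvd_mul_right _ _)
    rw [← hx8']; exact this
  have hpm : m ∣ p + 1 := by
    have : p ≡ x [MOD m] := hpx.of_dvd (dvd_mul_left _ _)
    exact ((this.add_right 1).dvd_iff dvd_rfl).mpr hxm'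
  have hp4 : p % 4 = 1 := by rw [hx8'] at hx8o; omega
  have h2m : 2 * m ∣ p + 1 :=
    Nat.Coprime.mul_dvd_of_dvd_of_dvd (Nat.coprime_two_left.mpr hm) (by omega) hpm
  refine ⟨p, hp, hpgt, hp4, by exact_mod_cast h2m, ?_⟩
  haveI : Fact p.Prime := ⟨hp⟩
  have hpodd : Odd p := Nat.odd_iff.mpr (by omega)
  have key : jacobiSym ((2 * m : ℕ) : ℤ) p = 1 := by
    push_cast
    rw [jacobiSym.mul_left, jacobiSym.at_two hpodd,
      ← jacobiSym.quadratic_reciprocity_one_mod_four hp4 hm]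
    have e : jacobiSym (p : ℤ) m = jacobiSym (-1) m := by
      apply jacobiSym.mod_left'
      apply Int.ModEq.symm
      rw [Int.modEq_iff_dvd]
      have : (m : ℤ) ∣ p + 1 := by exact_mod_cast hpm
      simpa using this
    rw [e, jacobiSym.at_neg_one hm]
    rcases hm4 with h | h
    · rw [ZMod.χ₄_nat_one_mod_four h, ZMod.χ₈_nat_eq_if_mod_eight, hp8]
      simp [c, h]; omega
    · rw [ZMod.χ₄_nat_three_mod_four h, ZMod.χ₈_nat_eq_if_mod_eight, hp8]
      simp [c, h]; omega
  rw [← jacobiSym.legendreSym.to_jacobiSym] at key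
  have hne : (((2 * m : ℕ) : ℤ) : ZMod p) ≠ 0 := by
    intro h
    rw [(legendreSym.eq_zero_iff p _).mpr h] at key
    exact absurd key (by norm_num)
  obtain ⟨y, hy⟩ := (legendreSym.eq_one_iff p hne).mp key
  obtain ⟨r, rfl⟩ := ZMod.intCast_surjective y
  refine ⟨r, ?_⟩
  rw [← ZMod.intCast_zmod_eq_zero_iff_dvd]
  push_cast at hy ⊢
  rw [hy]; ring

theorem aux_three (m : ℕ) (hm : Odd m) : ∃ a b c : ℚ, a ^ 2 + b ^ 2 + c ^ 2 = 2 * m := by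
  obtain ⟨p, hp, hlt, hp4, h1, r, hr⟩ := aux_prime m hm
  have hm0 : 0 < m := hm.pos
  have hnd : ¬ p ∣ 2 * m := fun h => by
    have := Nat.le_of_dvd (by positivity) h
    omega
  obtain ⟨Z, V, W, hW, h⟩ := aux_pigeon (2 * m) p (by positivity) hp hnd
    ((Nat.Prime.coprime_iff_not_dvd hp).mpr hnd).symm h1 r hr
  haveI : Fact p.Prime := ⟨hp⟩
  obtain ⟨a, b, hab⟩ := Nat.Prime.sq_add_sq (p := p) (by omega)
  have hW' : (W : ℚ) ≠ 0 := by exact_mod_cast hW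
  have hq : (Z : ℚ) ^ 2 + p * V ^ 2 = 2 * m * W ^ 2 := by exact_mod_cast h
  have hab' : (a : ℚ) ^ 2 + b ^ 2 = p := by exact_mod_cast hab
  refine ⟨Z / W, a * V / W, b * V / W, ?_⟩
  field_simp
  rw [← hab'] at hq
  linear_combination hq

theorem rat_pos_iff_three_squares (u : ℚ) :
    u > 0 ↔ ∃ v₁ v₂ v₃ : ℚ,
      (1 - u * (v₁ ^ 2 + v₂ ^ 2 + v₃ ^ 2)) * (1 - 2 * u * (v₁ ^ 2 + v₂ ^ 2 + v₃ ^ 2)) = 0 := by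
  constructor
  · intro hu
    have hnum : 0 < u.num := Rat.num_pos.mpr hu
    obtain ⟨a, ha⟩ : ∃ a : ℕ, (a : ℤ) = u.num := ⟨u.num.toNat, Int.toNat_of_nonneg hnum.le⟩
    have ha0 : a ≠ 0 := by omega
    have hd0 : u.den ≠ 0 := u.den_ne_zero
    have hu' : u = (a : ℚ) / u.den := by
      conv_lhs => rw [← Rat.num_div_den u, ← ha]
      simp
    obtain ⟨k, m, hm, hkm⟩ := Nat.exists_eq_two_pow_mul_odd (n := a * u.den)
      (mul_ne_zero ha0 hd0)
    obtain ⟨x, y, z, hxyz⟩ := aux_three m hm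
    have hA : (a : ℚ) ≠ 0 := by exact_mod_cast ha0
    have hD : (u.den : ℚ) ≠ 0 := by exact_mod_cast hd0
    have hn : (a : ℚ) * u.den = 2 ^ k * m := by exact_mod_cast hkm
    generalize (u.den : ℚ) = d at *
    subst hu'
    rcases Nat.even_or_odd' k with ⟨j, rfl | rfl⟩
    · refine ⟨x * 2 ^ j / (2 * a), y * 2 ^ j / (2 * a), z * 2 ^ j / (2 * a), ?_⟩
      apply mul_eq_zero_of_right
      rw [pow_mul'] at hn
      field_simp
      linear_combination 2 * hn - (2 ^ j) ^ 2 * hxyz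
    · refine ⟨x * 2 ^ j / a, y * 2 ^ j / a, z * 2 ^ j / a, ?_⟩
      apply mul_eq_zero_of_left
      rw [pow_succ, pow_mul'] at hn
      field_simp
      linear_combination hn - (2 ^ j) ^ 2 * hxyz
  · rintro ⟨x, y, z, h⟩
    by_contra hu
    push Not at hu
    have hs : 0 ≤ x ^ 2 + y ^ 2 + z ^ 2 := by positivity
    have := mul_nonneg (neg_nonneg.mpr hu) hs
    rcases mul_eq_zero.mp h with h | h <;> nlinarith
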